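/- A training rule ψ (an arbitrary function from profiles of types and initial models to models) is implementable — i.e., there exists a payment rule p such that (ψ, p) is DSIC — if and only if ψ satisfies cycle monotonicity: for every group i, every pair of types t_i, t'_i, every finite distinct sequence of types [t_i, t_i^1, …, t_i^k, t'_i] with k ≥ 0, and every profile of other groups' types and initial model (t⃗_{-i}, π₀), setting t_i^0 = t_i^{k+2} := t_i and t_i^{k+1} := t'_i, it holds that Σ_{j=0}^{k+1} l(t_i^j, t_i^{j+1}; t⃗_{-i}, π₀) ≥ 0. -/

import Mathlib

open Finset

noncomputable section

variable {X : Type*}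

/-- A model is a probability distribution on the finite outcome set `X`. -/
def IsModel [Fintype X] (π : X → ℝ) : Prop :=
  (∀ x, 0 ≤ π x) ∧ ∑ x, π x = 1

/-- A function on `X` has full support if it is everywhere positive. -/
def FullSupport (π : X → ℝ) : Prop :=
  ∀ x, 0 < π x

/-- A reward model normalized by summation. -/
def IsRewardSum [Fintype X] (r : X → ℝ) : Prop :=
  (∀ x, 0 ≤ r x) ∧ ∑ x, r x = 1

/-- A reward model normalized by maximum. -/
def IsRewardMax (r : X → ℝ) : Prop :=
  (∀ x, 0 ≤ r x) ∧ (∀ x, r x ≤ 1) ∧ ∃ x, r x = 1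

/-- The valuation of a model `π` under a reward model `r`. -/
def valuation [Fintype X] (π r : X → ℝ) : ℝ :=
  ∑ x, π x * r x

/-- The `f`-divergence between `π` and `π₀`. -/
def fDiv [Fintype X] (f : ℝ → ℝ) (π π₀ : X → ℝ) : ℝ :=
  ∑ x, π₀ x * f (π x / π₀ x)

/-- The affine social welfare. -/
def ASW [Fintype X] (f : ℝ → ℝ) {n : ℕ} (r : Fin n → X → ℝ) (w : Fin n → ℕ)
    (π π₀ : X → ℝ) : ℝ :=
  (∑ i, (w i : ℝ) * valuation π (r i)) - fDiv f π π₀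

/-- A SW-Max training rule: on every profile of reward models in the domain `Rdom`
and every full-support initial model, it outputs a model maximizing the affine social
welfare.  Weight vectors range over all of `ℕ` so that the rule is also defined on
profiles with a group removed (encoded by a zero weight). -/
def SWMaxRule [Fintype X] (f : ℝ → ℝ) (Rdom : (X → ℝ) → Prop) {n : ℕ}
    (ψ : (Fin n → X → ℝ) → (Fin n → ℕ) → (X → ℝ) → (X → ℝ)) : Prop :=
  ∀ (r : Fin n → X → ℝ) (w : Fin n → ℕ) (π₀ : X → ℝ),
    (∀ j, Rdom (r j)) → IsModel π₀ → FullSupport π₀ →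
      IsModel (ψ r w π₀) ∧
      ∀ π : X → ℝ, IsModel π → ASW f r w π π₀ ≤ ASW f r w (ψ r w π₀) π₀

/-- A type (reward model and size) is valid if the reward model lies in the domain
and the size lies in `{1, …, wbar}`. -/
def ValidType [Fintype X] (Rdom : (X → ℝ) → Prop) (wbar : ℕ)
    (t : (X → ℝ) × ℕ) : Prop :=
  Rdom t.1 ∧ 1 ≤ t.2 ∧ t.2 ≤ wbar

/-- `gain ψ i ts π₀ t' t` is the valuation gain of group `i` of true type `t` from
switching its report from `t'` to `t`, fixing the others' reports `ts`. -/
def gain [Fintype X] {n : ℕ}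
    (ψ : (Fin n → (X → ℝ) × ℕ) → (X → ℝ) → (X → ℝ))
    (i : Fin n) (ts : Fin n → (X → ℝ) × ℕ) (π₀ : X → ℝ)
    (t' t : (X → ℝ) × ℕ) : ℝ :=
  (t.2 : ℝ) * valuation (ψ (Function.update ts i t) π₀) t.1 -
    (t.2 : ℝ) * valuation (ψ (Function.update ts i t') π₀) t.1

/-- A payment rule `p` implements the training rule `ψ` in DSIC. -/
def DSICt [Fintype X] {n : ℕ} (Rdom : (X → ℝ) → Prop) (wbar : ℕ)
    (ψ : (Fin n → (X → ℝ) × ℕ) → (X → ℝ) → (X → ℝ))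
    (p : (Fin n → (X → ℝ) × ℕ) → (X → ℝ) → Fin n → ℝ) : Prop :=
  ∀ (ts : Fin n → (X → ℝ) × ℕ) (i : Fin n) (t' : (X → ℝ) × ℕ) (π₀ : X → ℝ),
    (∀ j, ValidType Rdom wbar (ts j)) → ValidType Rdom wbar t' →
    IsModel π₀ → FullSupport π₀ →
    ((ts i).2 : ℝ) * valuation (ψ ts π₀) (ts i).1 - p ts π₀ i ≥
      ((ts i).2 : ℝ) * valuation (ψ (Function.update ts i t') π₀) (ts i).1 -
        p (Function.update ts i t') π₀ i

/-- Cycle monotonicity: along every finite cycle through distinct valid types,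
the total valuation gain is non-negative. -/
def CycleMono [Fintype X] {n : ℕ} (Rdom : (X → ℝ) → Prop) (wbar : ℕ)
    (ψ : (Fin n → (X → ℝ) × ℕ) → (X → ℝ) → (X → ℝ)) : Prop :=
  ∀ (i : Fin n) (k : ℕ) (s : Fin (k + 2) → (X → ℝ) × ℕ),
    Function.Injective s → (∀ j, ValidType Rdom wbar (s j)) →
    ∀ (ts : Fin n → (X → ℝ) × ℕ) (π₀ : X → ℝ),
      (∀ j, ValidType Rdom wbar (ts j)) → IsModel π₀ → FullSupport π₀ →
      0 ≤ ∑ j : Fin (k + 2), gain ψ i ts π₀ (s j) (s (j + 1))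

/-- The weight of the walk from `a` to `b` whose list of intermediate vertices is given. -/
def walkWeight {α : Type*} (l : α → α → ℝ) : α → List α → α → ℝ
  | a, [], b => l a b
  | a, c :: L, b => l a c + walkWeight l c L b

theorem walkWeight_append_cons {α : Type*} (l : α → α → ℝ) (a b c : α) (L M : List α) :
    walkWeight l a (L ++ c :: M) b = walkWeight l a L c + walkWeight l c M b := by
  induction L generalizing a with
  | nil => rfl
  | cons d L ih => simp only [List.cons_append, walkWeight, ih, add_assoc]

theorem walkWeight_ofFn {α : Type*} (l : α → α → ℝ) (b : α) {k : ℕ} (s : Fin (k + 1) → α) :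
    walkWeight l (s 0) (List.ofFn fun i : Fin k => s i.succ) b =
      ∑ j : Fin k, l (s j.castSucc) (s j.succ) + l (s (Fin.last k)) b := by
  induction k with
  | zero => simp [walkWeight]
  | succ k ih =>
    rw [List.ofFn_succ, Fin.sum_univ_succ, walkWeight, ih (fun i => s i.succ)]
    simp [add_assoc]

theorem walkWeight_ofFn_closed {α : Type*} (l : α → α → ℝ) {k : ℕ} (s : Fin (k + 1) → α) :
    walkWeight l (s 0) (List.ofFn fun i : Fin k => s i.succ) (s 0) =
      ∑ j : Fin (k + 1), l (s j) (s (j + 1)) := by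
  rw [walkWeight_ofFn, Fin.sum_univ_castSucc]
  simp

theorem exists_eq_append_of_not_nodup {α : Type*} {L : List α} (h : ¬ L.Nodup) :
    ∃ (c : α) (L₁ L₂ L₃ : List α), L = L₁ ++ c :: (L₂ ++ c :: L₃) := by
  induction L with
  | nil => simp at h
  | cons a L ih =>
    by_cases ha : a ∈ L
    · obtain ⟨L₂, L₃, rfl⟩ := List.append_of_mem ha
      exact ⟨a, [], L₂, L₃, rfl⟩
    · obtain ⟨c, L₁, L₂, L₃, rfl⟩ := ih fun hL => h (List.nodup_cons.2 ⟨ha, hL⟩)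
      exact ⟨c, a :: L₁, L₂, L₃, rfl⟩

/-- If all cycles through distinct vertices of `S` have non-negative weight, so do all closed
walks in `S`. -/
theorem walkWeight_closed_nonneg {α : Type*} {l : α → α → ℝ} {S : Set α}
    (hloop : ∀ a ∈ S, 0 ≤ l a a)
    (hcycle : ∀ (k : ℕ) (s : Fin (k + 2) → α), Function.Injective s → (∀ j, s j ∈ S) →
      0 ≤ ∑ j : Fin (k + 2), l (s j) (s (j + 1)))
    (a : α) (L : List α) (ha : a ∈ S) (hL : ∀ x ∈ L, x ∈ S) :
    0 ≤ walkWeight l a L a := by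
  induction hn : L.length using Nat.strong_induction_on generalizing a L with
  | _ n ih =>
    subst hn
    by_cases haL : a ∈ L
    · obtain ⟨L₁, L₂, rfl⟩ := List.append_of_mem haL
      rw [walkWeight_append_cons]
      refine add_nonneg (ih _ ?_ a L₁ ha (fun x hx => hL x (by simp [hx])) rfl)
        (ih _ ?_ a L₂ ha (fun x hx => hL x (by simp [hx])) rfl) <;> grind
    by_cases hnd : L.Nodup
    · rcases L with _ | ⟨c, L⟩
      · exact hloop a ha
      · have hs := List.nodup_iff_injective_get.1 (List.nodup_cons.2 ⟨haL, hnd⟩)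
        have h := hcycle L.length (a :: c :: L).get hs fun j => by
          rcases List.mem_cons.1 (List.get_mem (a :: c :: L) j) with h | h
          · exact (congrArg (· ∈ S) h).mpr ha
          · exact hL _ h
        rw [← walkWeight_ofFn_closed] at h
        have e : (List.ofFn fun i : Fin (L.length + 1) => (a :: c :: L).get i.succ) = c :: L :=
          List.ofFn_get (c :: L)
        rwa [e] at h
    · obtain ⟨c, L₁, L₂, L₃, rfl⟩ := exists_eq_append_of_not_nodup hnd
      have h₁ : 0 ≤ walkWeight l c L₂ c :=
        ih _ (by simp; omega) c L₂ (hL c (by simp)) (fun x hx => hL x (by simp [hx])) rfl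
      have h₂ : 0 ≤ walkWeight l a (L₁ ++ c :: L₃) a :=
        ih _ (by simp) a _ ha
          (fun x hx => hL x (by
            simp only [List.mem_append, List.mem_cons] at hx ⊢; tauto)) rfl
      rw [walkWeight_append_cons] at h₂ ⊢
      rw [walkWeight_append_cons]
      linarith

/-- A weight function whose cycles in `S` are non-negative admits a potential on `S`. -/
theorem exists_potential {α : Type*} {l : α → α → ℝ} {S : Set α}
    (hloop : ∀ a ∈ S, 0 ≤ l a a)
    (hcycle : ∀ (k : ℕ) (s : Fin (k + 2) → α), Function.Injective s → (∀ j, s j ∈ S) →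
      0 ≤ ∑ j : Fin (k + 2), l (s j) (s (j + 1))) :
    ∃ q : α → ℝ, ∀ a ∈ S, ∀ b ∈ S, q b - q a ≤ l a b := by
  rcases S.eq_empty_or_nonempty with rfl | ⟨o, ho⟩
  · exact ⟨0, by simp⟩
  let q (b : α) : ℝ := ⨅ L : {L : List α // ∀ x ∈ L, x ∈ S}, walkWeight l o L.1 b
  have : Nonempty {L : List α // ∀ x ∈ L, x ∈ S} := ⟨⟨[], by simp⟩⟩
  have append_mem {b : α} (hb : b ∈ S) (L : {L : List α // ∀ x ∈ L, x ∈ S}) :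
      ∀ x ∈ L.1 ++ [b], x ∈ S := by
    intro x hx
    rcases List.mem_append.1 hx with hx | hx
    · exact L.2 x hx
    · exact List.mem_singleton.1 hx ▸ hb
  have bdd {b : α} (hb : b ∈ S) :
      BddBelow (Set.range fun L : {L : List α // ∀ x ∈ L, x ∈ S} => walkWeight l o L.1 b) := by
    refine ⟨-l b o, ?_⟩
    rintro _ ⟨L, rfl⟩
    have h := walkWeight_closed_nonneg hloop hcycle o _ ho (append_mem hb L)
    rw [walkWeight_append_cons] at h
    simp only [walkWeight] at h
    linarith
  refine ⟨q, fun a ha b hb => ?_⟩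
  suffices q b - l a b ≤ q a by linarith
  refine le_ciInf fun L => ?_
  have h : q b ≤ walkWeight l o (L.1 ++ [a]) b := ciInf_le (bdd hb) ⟨_, append_mem ha L⟩
  rw [walkWeight_append_cons] at h
  simp only [walkWeight] at h
  linarith

theorem gain_update [Fintype X] {n : ℕ}
    (ψ : (Fin n → (X → ℝ) × ℕ) → (X → ℝ) → (X → ℝ))
    (i : Fin n) (ts : Fin n → (X → ℝ) × ℕ) (π₀ : X → ℝ) (t : (X → ℝ) × ℕ) :
    gain ψ i (Function.update ts i t) π₀ = gain ψ i ts π₀ := by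
  funext a b
  simp [gain]

theorem gain_self [Fintype X] {n : ℕ}
    (ψ : (Fin n → (X → ℝ) × ℕ) → (X → ℝ) → (X → ℝ))
    (i : Fin n) (ts : Fin n → (X → ℝ) × ℕ) (π₀ : X → ℝ) (t : (X → ℝ) × ℕ) :
    gain ψ i ts π₀ t t = 0 :=
  sub_self _

/-- a training rule is implementable if and only if it satisfies
cycle monotonicity. -/
theorem implementable_iff_cycle_monotone
    [Fintype X] [Nonempty X] {n : ℕ} (wbar : ℕ) (hwbar : 1 ≤ wbar)
    (Rdom : (X → ℝ) → Prop)
    (hdom : Rdom = (IsRewardSum (X := X)) ∨ Rdom = (IsRewardMax (X := X)))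
    (ψ : (Fin n → (X → ℝ) × ℕ) → (X → ℝ) → (X → ℝ))
    (hmodel : ∀ (ts : Fin n → (X → ℝ) × ℕ) (π₀ : X → ℝ),
      (∀ j, ValidType Rdom wbar (ts j)) → IsModel π₀ → FullSupport π₀ →
      IsModel (ψ ts π₀)) :
    (∃ p, DSICt Rdom wbar ψ p) ↔ CycleMono Rdom wbar ψ := by
  constructor
  · rintro ⟨p, hp⟩ i k s - hs ts π₀ hts hπ₀ hfull
    have hle (j : Fin (k + 2)) :
        p (Function.update ts i (s (j + 1))) π₀ i - p (Function.update ts i (s j)) π₀ i ≤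
          gain ψ i ts π₀ (s j) (s (j + 1)) := by
      have h := hp (Function.update ts i (s (j + 1))) i (s j) π₀
        (fun m => by
          rcases eq_or_ne m i with rfl | hm
          · simpa using hs (j + 1)
          · simpa [hm] using hts m) (hs j) hπ₀ hfull
      simp only [Function.update_self, Function.update_idem] at h
      simp only [gain]
      linarith
    refine le_of_eq_of_le ?_ (Finset.sum_le_sum fun j _ => hle j)
    rw [Finset.sum_sub_distrib, eq_comm, sub_eq_zero]
    exact Equiv.sum_comp (Equiv.addRight (1 : Fin (k + 2)))
      fun j => p (Function.update ts i (s j)) π₀ i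
  · intro hcm
    let IsPotential (l : (X → ℝ) × ℕ → (X → ℝ) × ℕ → ℝ) (q : (X → ℝ) × ℕ → ℝ) : Prop :=
      ∀ a ∈ {t | ValidType Rdom wbar t}, ∀ b ∈ {t | ValidType Rdom wbar t}, q b - q a ≤ l a b
    have key (l) : ∃ q, (∃ q', IsPotential l q') → IsPotential l q := by
      by_cases h : ∃ q', IsPotential l q'
      · exact h.imp fun q hq _ => hq
      · exact ⟨0, fun h' => absurd h' h⟩
    choose Q hQ using key
    refine ⟨fun ts π₀ i => Q (gain ψ i ts π₀) (ts i), ?_⟩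
    intro ts i t' π₀ hts ht' hπ₀ hfull
    have h := hQ (gain ψ i ts π₀)
      (exists_potential (fun a _ => (gain_self ψ i ts π₀ a).ge)
        fun k s hinj hs => hcm i k s hinj hs ts π₀ hts hπ₀ hfull) t' ht' (ts i) (hts i)
    simp only [gain_update, Function.update_self]
    rw [gain, Function.update_eq_self] at h
    linarith
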